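/- arXiv:2005.10660 — 7 statements merged into one kernel-verified Lean document; each statement's English description precedes it below -/
import Mathlib

section
/- Let u* ∈ U be a minimizer over U of the function u ↦ sup_{π∈Π} F(θ, z, π, u), and set π* := Proj_Π((θ + z + u*)/(1 − δ)). Then F(θ, z, π*, u) ≥ F(θ, z, π*, u*) for every u ∈ U. -/
open RealInnerProductSpace

/-- The Hamiltonian `F(θ, z, π, u)`. -/
noncomputable def F {d : ℕ} (δ : ℝ) (θ z p u : EuclideanSpace ℝ (Fin d)) : ℝ :=
  -(1/2) * δ * (1 - δ) * ‖p‖^2 + δ * ⟪p, θ + z + u⟫ + ⟪z, u⟫ + (1/2) * ‖z‖^2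

section Projection

variable {E : Type*} [NormedAddCommGroup E] [InnerProductSpace ℝ E]

/-- The variational inequality for a nearest point of a convex set. -/
theorem inner_sub_nearest_nonpos {K : Set E} (hK : Convex ℝ K) {x v : E} (hv : v ∈ K)
    (hmin : ∀ y ∈ K, ‖x - v‖ ≤ ‖x - y‖) {w : E} (hw : w ∈ K) : ⟪x - v, w - v⟫ ≤ 0 := by
  have : Nonempty K := ⟨⟨v, hv⟩⟩
  refine (norm_eq_iInf_iff_real_inner_le_zero hK hv).1 (le_antisymm ?_ ?_) w hw
  · exact le_ciInf fun y => hmin y y.2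
  · exact ciInf_le (f := fun y : K => ‖x - y‖)
      ⟨0, Set.forall_mem_range.2 fun _ => norm_nonneg _⟩ ⟨v, hv⟩

/-- Nearest points of a convex set depend nonexpansively on the base point. -/
theorem norm_nearest_sub_nearest_le {K : Set E} (hK : Convex ℝ K) {x y v w : E}
    (hv : v ∈ K) (hvmin : ∀ a ∈ K, ‖x - v‖ ≤ ‖x - a‖)
    (hw : w ∈ K) (hwmin : ∀ a ∈ K, ‖y - w‖ ≤ ‖y - a‖) : ‖v - w‖ ≤ ‖x - y‖ := by
  have h₁ := inner_sub_nearest_nonpos hK hv hvmin hw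
  have h₂ := inner_sub_nearest_nonpos hK hw hwmin hv
  have h₃ : ‖v - w‖ ^ 2 = ⟪x - y, v - w⟫ + ⟪x - v, w - v⟫ + ⟪y - w, v - w⟫ := by
    rw [← real_inner_self_eq_norm_sq]
    simp only [inner_sub_left, inner_sub_right]
    ring
  have h₄ := real_inner_le_norm (x - y) (v - w)
  by_contra! h
  nlinarith [norm_nonneg (x - y), norm_nonneg (v - w)]

end Projection

/-- Completing the square in `F`: up to a term independent of `p`, it is a negative multiple of
the squared distance from `p` to `(θ + z + u) / (1 - δ)`. -/
theorem F_sub_F_eq {d : ℕ} {δ : ℝ} (hδ : δ ≠ 1) (θ z p q u : EuclideanSpace ℝ (Fin d)) :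
    F δ θ z q u - F δ θ z p u = 1 / 2 * δ * (1 - δ) *
      (‖(1 - δ)⁻¹ • (θ + z + u) - p‖ ^ 2 - ‖(1 - δ)⁻¹ • (θ + z + u) - q‖ ^ 2) := by
  have h : 1 - δ ≠ 0 := sub_ne_zero.2 hδ.symm
  simp only [F, norm_sub_sq_real, real_inner_smul_left, real_inner_comm (θ + z + u)]
  field_simp
  ring

/-- A nearest point of `P` to `(θ + z + u) / (1 - δ)` maximizes `F` over `P`. -/
theorem F_le_F_of_nearest {d : ℕ} {δ : ℝ} (hδ : δ ∈ Set.Ioo (0:ℝ) 1)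
    {θ z p q u : EuclideanSpace ℝ (Fin d)}
    (h : ‖(1 - δ)⁻¹ • (θ + z + u) - q‖ ≤ ‖(1 - δ)⁻¹ • (θ + z + u) - p‖) :
    F δ θ z p u ≤ F δ θ z q u := by
  rw [← sub_nonneg, F_sub_F_eq hδ.2.ne]
  have h₁ : 0 < 1 - δ := sub_pos.2 hδ.2
  have h₀ := hδ.1
  exact mul_nonneg (by positivity) (sub_nonneg.2 (by gcongr))

theorem F_add_smul {d : ℕ} (δ t : ℝ) (θ z p u w : EuclideanSpace ℝ (Fin d)) :
    F δ θ z p (u + t • w) = F δ θ z p u + t * ⟪δ • p + z, w⟫ := by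
  simp only [F, inner_add_right, inner_add_left, real_inner_smul_left, real_inner_smul_right]
  ring

/-- if `u*` minimizes `u ↦ sup_{π∈Π} F(θ,z,π,u)` over `U` and
`π* = Proj_Π((θ+z+u*)/(1-δ))`, then `F(θ,z,π*,u) ≥ F(θ,z,π*,u*)` for all `u ∈ U`. -/
theorem stmt_1 {d : ℕ} (hd : 1 ≤ d) {δ : ℝ} (hδ : δ ∈ Set.Ioo (0:ℝ) 1)
    (P U : Set (EuclideanSpace ℝ (Fin d)))
    (hPne : P.Nonempty) (hPcl : IsClosed P) (hPconv : Convex ℝ P)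
    (hP0 : (0 : EuclideanSpace ℝ (Fin d)) ∈ P)
    (hUne : U.Nonempty) (hUcomp : IsCompact U) (hUconv : Convex ℝ U)
    (projP : EuclideanSpace ℝ (Fin d) → EuclideanSpace ℝ (Fin d))
    (hprojP : ∀ x, projP x ∈ P ∧ ∀ y ∈ P, ‖x - projP x‖ ≤ ‖x - y‖)
    (θ z : EuclideanSpace ℝ (Fin d))
    (ustar : EuclideanSpace ℝ (Fin d)) (hustarU : ustar ∈ U)
    (hustar : ∀ u ∈ U, sSup ((fun p => F δ θ z p ustar) '' P) ≤
      sSup ((fun p => F δ θ z p u) '' P)) :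
    ∀ u ∈ U, F δ θ z (projP ((1 - δ)⁻¹ • (θ + z + ustar))) ustar ≤
      F δ θ z (projP ((1 - δ)⁻¹ • (θ + z + ustar))) u := by
  intro u hu
  set x : EuclideanSpace ℝ (Fin d) → EuclideanSpace ℝ (Fin d) :=
    fun v => (1 - δ)⁻¹ • (θ + z + v) with hx
  set w := u - ustar with hw
  set q := projP (x ustar)
  have hsup : ∀ v, IsGreatest ((fun p => F δ θ z p v) '' P) (F δ θ z (projP (x v)) v) :=
    fun v => ⟨⟨_, (hprojP _).1, rfl⟩, Set.forall_mem_image.2 fun p hp =>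
      F_le_F_of_nearest hδ ((hprojP _).2 p hp)⟩
  have h₁ : 0 < 1 - δ := sub_pos.2 hδ.2
  have key : ∀ t ∈ Set.Ioc (0:ℝ) 1,
      -(t * (δ * (1 - δ)⁻¹ * ‖w‖ ^ 2)) ≤ ⟪δ • q + z, w⟫ := by
    intro t ht
    have hvU : ustar + t • w ∈ U := hUconv.add_smul_sub_mem hustarU hu ⟨ht.1.le, ht.2⟩
    set r := projP (x (ustar + t • w))
    have hle := hustar _ hvU
    rw [(hsup _).csSup_eq, (hsup _).csSup_eq] at hle
    have hle' : F δ θ z r ustar ≤ F δ θ z r (ustar + t • w) :=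
      ((hsup ustar).2 ⟨r, (hprojP _).1, rfl⟩).trans hle
    rw [F_add_smul] at hle'
    have hpos : 0 ≤ ⟪δ • r + z, w⟫ :=
      nonneg_of_mul_nonneg_right (by linarith) ht.1
    have hdist : ‖r - q‖ ≤ t * (1 - δ)⁻¹ * ‖w‖ := by
      have h := norm_nearest_sub_nearest_le hPconv (hprojP (x (ustar + t • w))).1
        (hprojP _).2 (hprojP (x ustar)).1 (hprojP _).2
      have hxw : x (ustar + t • w) - x ustar = (t * (1 - δ)⁻¹) • w := by
        simp only [hx]
        module
      rwa [hxw, norm_smul, Real.norm_of_nonneg (mul_nonneg ht.1.le (inv_nonneg.2 h₁.le))] at h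
    have hdiff : ⟪δ • r + z, w⟫ = ⟪δ • q + z, w⟫ + δ * ⟪r - q, w⟫ := by
      simp only [inner_add_left, inner_sub_left, real_inner_smul_left]
      ring
    have hcs : ⟪r - q, w⟫ ≤ t * (1 - δ)⁻¹ * ‖w‖ * ‖w‖ :=
      (real_inner_le_norm _ _).trans (by gcongr)
    have := mul_le_mul_of_nonneg_left hcs hδ.1.le
    linarith
  have hlim : Filter.Tendsto (fun t : ℝ => -(t * (δ * (1 - δ)⁻¹ * ‖w‖ ^ 2)))
      (nhdsWithin 0 (Set.Ioi 0)) (nhds 0) := by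
    have h : Continuous fun t : ℝ => -(t * (δ * (1 - δ)⁻¹ * ‖w‖ ^ 2)) := by fun_prop
    simpa using (h.tendsto 0).mono_left nhdsWithin_le_nhds
  have hnonneg : 0 ≤ ⟪δ • q + z, w⟫ :=
    le_of_tendsto hlim (Filter.mem_of_superset (Ioc_mem_nhdsGT one_pos) key)
  have hu_eq : u = ustar + (1:ℝ) • w := by simp [hw]
  rw [hu_eq, F_add_smul]
  linarith
end

section
/- Suppose θ : ℝ^d → ℝ^d satisfies ‖θ(v)‖ ≤ K_θ for all v and is Lipschitz with constant C_θ, and let K_u := max_{u∈U} ‖u‖. Define α*(v,z,u) := Proj_Π((θ(v) + z + u)/(1 − δ)). Then for all v, v̄, z ∈ ℝ^d and u ∈ U: |F(θ(v), z, α*(v,z,u), u) − F(θ(v̄), z, α*(v̄,z,u), u)| ≤ 3·(δ/(1−δ))·(K_θ + ‖z‖ + K_u)·C_θ·‖v − v̄‖. -/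
open RealInnerProductSpace

/-- A nearest point of `P` to `(1 - δ)⁻¹ • (a + z + u)` maximizes `F δ a z · u` over `P`. -/
theorem F_le_of_nearest {d : ℕ} {δ : ℝ} (hδ : δ ∈ Set.Ioo (0:ℝ) 1)
    (a z u p q : EuclideanSpace ℝ (Fin d))
    (h : ‖(1 - δ)⁻¹ • (a + z + u) - p‖ ≤ ‖(1 - δ)⁻¹ • (a + z + u) - q‖) :
    F δ a z q u ≤ F δ a z p u := by
  obtain ⟨h0, h1⟩ := hδ
  have h2 : 0 < 1 - δ := by linarith
  have hsq := pow_le_pow_left₀ (norm_nonneg _) h 2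
  rw [norm_sub_sq_real, norm_sub_sq_real, real_inner_smul_left, real_inner_smul_left,
    real_inner_comm p, real_inner_comm q] at hsq
  have hm := mul_le_mul_of_nonneg_left hsq (mul_pos h0 h2).le
  have hc : (1 - δ) * (1 - δ)⁻¹ = 1 := mul_inv_cancel₀ h2.ne'
  unfold F
  linear_combination (1 / 2) * hm + δ * (⟪p, a + z + u⟫ - ⟪q, a + z + u⟫) * hc

theorem F_sub_F_left {d : ℕ} (δ : ℝ) (a b z p u : EuclideanSpace ℝ (Fin d)) :
    F δ a z p u - F δ b z p u = δ * ⟪p, a - b⟫ := by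
  simp only [F, inner_add_right, inner_sub_right]
  ring

theorem norm_le_two_mul_of_norm_sub_le {E : Type*} [SeminormedAddCommGroup E] {x p : E}
    (h : ‖x - p‖ ≤ ‖x‖) : ‖p‖ ≤ 2 * ‖x‖ := by
  linarith [norm_le_norm_add_norm_sub x p]

/-- Lipschitz estimate in the factor variable `v` of
`F(θ(v), z, α*(v,z,u), u)` with `α*(v,z,u) = Proj_Π((θ(v)+z+u)/(1-δ))`. -/
theorem stmt_3 {d : ℕ} (hd : 1 ≤ d) {δ : ℝ} (hδ : δ ∈ Set.Ioo (0:ℝ) 1)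
    (P U : Set (EuclideanSpace ℝ (Fin d)))
    (hPne : P.Nonempty) (hPcl : IsClosed P) (hPconv : Convex ℝ P)
    (hP0 : (0 : EuclideanSpace ℝ (Fin d)) ∈ P)
    (hUne : U.Nonempty) (hUcomp : IsCompact U) (hUconv : Convex ℝ U)
    (projP : EuclideanSpace ℝ (Fin d) → EuclideanSpace ℝ (Fin d))
    (hprojP : ∀ x, projP x ∈ P ∧ ∀ y ∈ P, ‖x - projP x‖ ≤ ‖x - y‖)
    (θ : EuclideanSpace ℝ (Fin d) → EuclideanSpace ℝ (Fin d))
    (Kθ Cθ Ku : ℝ)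
    (hKθ : ∀ v, ‖θ v‖ ≤ Kθ)
    (hCθ : ∀ v vb, ‖θ v - θ vb‖ ≤ Cθ * ‖v - vb‖)
    (hKu : IsGreatest ((fun u => ‖u‖) '' U) Ku) :
    ∀ (v vb z : EuclideanSpace ℝ (Fin d)), ∀ u ∈ U,
      |F δ (θ v) z (projP ((1 - δ)⁻¹ • (θ v + z + u))) u -
        F δ (θ vb) z (projP ((1 - δ)⁻¹ • (θ vb + z + u))) u| ≤
      3 * (δ / (1 - δ)) * (Kθ + ‖z‖ + Ku) * Cθ * ‖v - vb‖ := by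
  have h0 : 0 < δ := hδ.1
  have h2 : 0 < 1 - δ := by linarith [hδ.2]
  intro v vb z u hu
  have key : ∀ w wb : EuclideanSpace ℝ (Fin d),
      F δ (θ w) z (projP ((1 - δ)⁻¹ • (θ w + z + u))) u -
        F δ (θ wb) z (projP ((1 - δ)⁻¹ • (θ wb + z + u))) u ≤
      3 * (δ / (1 - δ)) * (Kθ + ‖z‖ + Ku) * Cθ * ‖w - wb‖ := by
    intro w wb
    set x := (1 - δ)⁻¹ • (θ w + z + u) with hx
    have hmax := F_le_of_nearest hδ (θ wb) z u _ (projP x)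
      ((hprojP ((1 - δ)⁻¹ • (θ wb + z + u))).2 _ (hprojP x).1)
    have hp : ‖projP x‖ ≤ 2 * ‖x‖ :=
      norm_le_two_mul_of_norm_sub_le (by simpa using (hprojP x).2 0 hP0)
    have hxn : ‖x‖ ≤ (1 - δ)⁻¹ * (Kθ + ‖z‖ + Ku) := by
      rw [hx, norm_smul, Real.norm_of_nonneg (inv_pos.2 h2).le]
      gcongr
      exact norm_add₃_le.trans (by gcongr; exacts [hKθ w, hKu.2 ⟨u, hu, rfl⟩])
    have hp3 : ‖projP x‖ ≤ 3 * ((1 - δ)⁻¹ * (Kθ + ‖z‖ + Ku)) := by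
      linarith [norm_nonneg x]
    calc _ ≤ F δ (θ w) z (projP x) u - F δ (θ wb) z (projP x) u := by linarith
      _ = δ * ⟪projP x, θ w - θ wb⟫ := F_sub_F_left ..
      _ ≤ δ * (‖projP x‖ * ‖θ w - θ wb‖) := by
        gcongr
        exact real_inner_le_norm _ _
      _ ≤ δ * (3 * ((1 - δ)⁻¹ * (Kθ + ‖z‖ + Ku)) * (Cθ * ‖w - wb‖)) :=
        mul_le_mul_of_nonneg_left (mul_le_mul hp3 (hCθ w wb) (norm_nonneg _)
          ((norm_nonneg _).trans hp3)) h0.le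
      _ = _ := by ring
  refine abs_sub_le_iff.2 ⟨key v vb, ?_⟩
  rw [norm_sub_rev]
  exact key vb v
end

section
/- Suppose θ : ℝ^d → ℝ^d satisfies ‖θ(v)‖ ≤ K_θ for all v and is Lipschitz with constant C_θ, and let K_u := max_{u∈U} ‖u‖. Define G(v, z) := inf_{u∈U} sup_{π∈Π} F(θ(v), z, π, u). Then for all v, v̄, z ∈ ℝ^d: |G(v, z) − G(v̄, z)| ≤ (3δC_θ/(1−δ))·max(K_θ + K_u, 1)·(1 + ‖z‖)·‖v − v̄‖. -/
open RealInnerProductSpace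

/-- The driver `G(v,z) = inf_{u∈U} sup_{π∈Π} F(θ(v), z, π, u)`. -/
noncomputable def G {d : ℕ} (δ : ℝ) (P U : Set (EuclideanSpace ℝ (Fin d)))
    (θ : EuclideanSpace ℝ (Fin d) → EuclideanSpace ℝ (Fin d))
    (v z : EuclideanSpace ℝ (Fin d)) : ℝ :=
  sInf ((fun u => sSup ((fun p => F δ (θ v) z p u) '' P)) '' U)

theorem F_zero_right {d : ℕ} (δ : ℝ) (θ z u : EuclideanSpace ℝ (Fin d)) :
    F δ θ z 0 u = ⟪z, u⟫ + (1/2) * ‖z‖^2 := by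
  simp [F]

theorem bddAbove_F_image {d : ℕ} {δ : ℝ} (hδ : δ ∈ Set.Ioo (0:ℝ) 1)
    (P : Set (EuclideanSpace ℝ (Fin d))) (θ z u : EuclideanSpace ℝ (Fin d)) :
    BddAbove ((fun p => F δ θ z p u) '' P) := by
  obtain ⟨h0, h1⟩ := hδ
  have h1' : 0 < 1 - δ := by linarith
  refine ⟨δ * (‖θ + z + u‖^2 / (2 * (1 - δ))) + ⟪z, u⟫ + (1/2) * ‖z‖^2, ?_⟩
  rintro _ ⟨p, -, rfl⟩
  have hin := real_inner_le_norm p (θ + z + u)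
  have key : -(1/2) * (1 - δ) * ‖p‖^2 + ‖p‖ * ‖θ + z + u‖ ≤
      ‖θ + z + u‖^2 / (2 * (1 - δ)) := by
    rw [le_div_iff₀ (by positivity)]
    nlinarith [sq_nonneg ((1 - δ) * ‖p‖ - ‖θ + z + u‖)]
  have h2 := mul_le_mul_of_nonneg_left key h0.le
  have h3 := mul_le_mul_of_nonneg_left hin h0.le
  simp only [F]
  linarith

/-- Points `p` of norm above `2‖θ + z + u‖ / (1 - δ)` do worse than `p = 0`, and on the remaining
ones `F` is Lipschitz in `θ`. -/
theorem sSup_F_le_add {d : ℕ} {δ : ℝ} (hδ : δ ∈ Set.Ioo (0:ℝ) 1)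
    {P : Set (EuclideanSpace ℝ (Fin d))} (hP0 : 0 ∈ P)
    (θ θ' z u : EuclideanSpace ℝ (Fin d)) :
    sSup ((fun p => F δ θ z p u) '' P) ≤ sSup ((fun p => F δ θ' z p u) '' P) +
      2 * δ / (1 - δ) * ‖θ + z + u‖ * ‖θ - θ'‖ := by
  have hbdd := bddAbove_F_image hδ P θ' z u
  obtain ⟨h0, h1⟩ := hδ
  have h1' : 0 < 1 - δ := by linarith
  refine csSup_le (Set.Nonempty.image _ ⟨0, hP0⟩) ?_
  rintro _ ⟨p, hp, rfl⟩
  dsimp only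
  rcases le_total ‖p‖ (2 * ‖θ + z + u‖ / (1 - δ)) with h | h
  · have hle := le_csSup hbdd (Set.mem_image_of_mem _ hp)
    have hdiff : F δ θ z p u = F δ θ' z p u + δ * ⟪p, θ - θ'⟫ := by
      simp only [F, inner_add_right, inner_sub_right]
      ring
    have hb : δ * ⟪p, θ - θ'⟫ ≤ 2 * δ / (1 - δ) * ‖θ + z + u‖ * ‖θ - θ'‖ := calc
      δ * ⟪p, θ - θ'⟫ ≤ δ * (2 * ‖θ + z + u‖ / (1 - δ) * ‖θ - θ'‖) := by
        gcongr
        exact (real_inner_le_norm _ _).trans (by gcongr)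
      _ = _ := by ring
    linarith
  · have hle := le_csSup hbdd (Set.mem_image_of_mem _ hP0)
    rw [F_zero_right] at hle
    rw [div_le_iff₀ h1'] at h
    have hin := real_inner_le_norm p (θ + z + u)
    have h2 : -(1/2) * (1 - δ) * ‖p‖^2 + ⟪p, θ + z + u⟫ ≤ 0 := by
      nlinarith [mul_le_mul_of_nonneg_left h (norm_nonneg p)]
    have h3 := mul_le_mul_of_nonneg_left h2 h0.le
    have h4 : 0 ≤ 2 * δ / (1 - δ) * ‖θ + z + u‖ * ‖θ - θ'‖ := by positivity
    have h5 : F δ θ z p u ≤ ⟪z, u⟫ + (1/2) * ‖z‖^2 := by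
      simp only [F]
      linarith
    linarith

theorem csInf_image_le_add {α : Type*} {U : Set α} (hU : U.Nonempty) {f g : α → ℝ} {B : ℝ}
    (hf : BddBelow (f '' U)) (h : ∀ u ∈ U, f u ≤ g u + B) :
    sInf (f '' U) ≤ sInf (g '' U) + B := by
  rw [← sub_le_iff_le_add]
  refine le_csInf (hU.image _) ?_
  rintro _ ⟨u, hu, rfl⟩
  linarith [csInf_le hf (Set.mem_image_of_mem f hu), h u hu]

theorem bddBelow_sSup_F_image {d : ℕ} {δ : ℝ} (hδ : δ ∈ Set.Ioo (0:ℝ) 1)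
    {P U : Set (EuclideanSpace ℝ (Fin d))} (hP0 : 0 ∈ P) {K : ℝ} (hK : ∀ u ∈ U, ‖u‖ ≤ K)
    (θ z : EuclideanSpace ℝ (Fin d)) :
    BddBelow ((fun u => sSup ((fun p => F δ θ z p u) '' P)) '' U) := by
  refine ⟨-(‖z‖ * K), ?_⟩
  rintro _ ⟨u, hu, rfl⟩
  have hle := le_csSup (bddAbove_F_image hδ P θ z u) (Set.mem_image_of_mem _ hP0)
  dsimp only at hle ⊢
  rw [F_zero_right] at hle
  have h1 := neg_le_of_abs_le (abs_real_inner_le_norm z u)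
  have h2 := mul_le_mul_of_nonneg_left (hK u hu) (norm_nonneg z)
  nlinarith [sq_nonneg ‖z‖]

/-- Lipschitz continuity of `G` in the factor variable `v`. -/
theorem stmt_4 {d : ℕ} (hd : 1 ≤ d) {δ : ℝ} (hδ : δ ∈ Set.Ioo (0:ℝ) 1)
    (P U : Set (EuclideanSpace ℝ (Fin d)))
    (hPne : P.Nonempty) (hPcl : IsClosed P) (hPconv : Convex ℝ P)
    (hP0 : (0 : EuclideanSpace ℝ (Fin d)) ∈ P)
    (hUne : U.Nonempty) (hUcomp : IsCompact U) (hUconv : Convex ℝ U)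
    (θ : EuclideanSpace ℝ (Fin d) → EuclideanSpace ℝ (Fin d))
    (Kθ Cθ Ku : ℝ)
    (hKθ : ∀ v, ‖θ v‖ ≤ Kθ)
    (hCθ : ∀ v vb, ‖θ v - θ vb‖ ≤ Cθ * ‖v - vb‖)
    (hKu : IsGreatest ((fun u => ‖u‖) '' U) Ku) :
    ∀ (v vb z : EuclideanSpace ℝ (Fin d)),
      |G δ P U θ v z - G δ P U θ vb z| ≤
      (3 * δ * Cθ / (1 - δ)) * max (Kθ + Ku) 1 * (1 + ‖z‖) * ‖v - vb‖ := by
  have hK : ∀ u ∈ U, ‖u‖ ≤ Ku := fun u hu => hKu.2 (Set.mem_image_of_mem _ hu)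
  have one_sided : ∀ v vb z : EuclideanSpace ℝ (Fin d), G δ P U θ v z ≤ G δ P U θ vb z +
      (3 * δ * Cθ / (1 - δ)) * max (Kθ + Ku) 1 * (1 + ‖z‖) * ‖v - vb‖ := by
    intro v vb z
    refine csInf_image_le_add hUne (bddBelow_sSup_F_image hδ hP0 hK (θ v) z) fun u hu => ?_
    refine (sSup_F_le_add hδ hP0 (θ v) (θ vb) z u).trans ?_
    have h0 : 0 < δ := hδ.1
    have h1 : 0 < 1 - δ := by linarith [hδ.2]
    have hw : ‖θ v + z + u‖ ≤ max (Kθ + Ku) 1 * (1 + ‖z‖) := by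
      have h2 := norm_add₃_le (a := θ v) (b := z) (c := u)
      have h3 := mul_le_mul_of_nonneg_right (le_max_right (Kθ + Ku) 1) (norm_nonneg z)
      linarith [hKθ v, hK u hu, le_max_left (Kθ + Ku) 1]
    refine add_le_add le_rfl ?_
    calc 2 * δ / (1 - δ) * ‖θ v + z + u‖ * ‖θ v - θ vb‖
        ≤ 3 * δ / (1 - δ) * (max (Kθ + Ku) 1 * (1 + ‖z‖)) * (Cθ * ‖v - vb‖) := by
          gcongr
          · norm_num
          · exact hCθ v vb
      _ = _ := by ring
  intro v vb z
  have h1 := one_sided v vb z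
  have h2 := one_sided vb v z
  rw [norm_sub_rev vb v] at h2
  exact abs_sub_le_iff.2 ⟨by linarith, by linarith⟩
end

section
/- Suppose θ : ℝ^d → ℝ^d satisfies ‖θ(v)‖ ≤ K_θ for all v, and let K_u := max_{u∈U} ‖u‖. Define G(v, z) := inf_{u∈U} sup_{π∈Π} F(θ(v), z, π, u). Then for every v ∈ ℝ^d: 0 ≤ G(v, 0) ≤ δ(K_θ + K_u)² / (2(1 − δ)); in particular G(·, 0) is uniformly bounded. -/
open RealInnerProductSpace

theorem F_zero_le {d : ℕ} {δ : ℝ} (hδ : δ ∈ Set.Ioo (0:ℝ) 1)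
    (θ p u : EuclideanSpace ℝ (Fin d)) :
    F δ θ 0 p u ≤ δ * ‖θ + u‖^2 / (2 * (1 - δ)) := by
  obtain ⟨h0, h1⟩ := hδ
  have hpos : 0 < 1 - δ := sub_pos.mpr h1
  have hinner : ⟪p, θ + u⟫ ≤ ‖p‖ * ‖θ + u‖ := real_inner_le_norm _ _
  rw [le_div_iff₀ (by positivity)]
  simp only [F, add_zero, inner_zero_left, norm_zero]
  have hcs := mul_le_mul_of_nonneg_left hinner (mul_pos h0 hpos).le
  nlinarith [mul_nonneg h0.le (sq_nonneg ((1 - δ) * ‖p‖ - ‖θ + u‖))]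

theorem F_zero_zero {d : ℕ} (δ : ℝ) (θ u : EuclideanSpace ℝ (Fin d)) : F δ θ 0 0 u = 0 := by
  simp [F]

/-- the bound `0 ≤ G(v,0) ≤ δ(Kθ + Ku)²/(2(1-δ))` for every `v`. -/
theorem stmt_6 {d : ℕ} (hd : 1 ≤ d) {δ : ℝ} (hδ : δ ∈ Set.Ioo (0:ℝ) 1)
    (P U : Set (EuclideanSpace ℝ (Fin d)))
    (hPne : P.Nonempty) (hPcl : IsClosed P) (hPconv : Convex ℝ P)
    (hP0 : (0 : EuclideanSpace ℝ (Fin d)) ∈ P)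
    (hUne : U.Nonempty) (hUcomp : IsCompact U) (hUconv : Convex ℝ U)
    (θ : EuclideanSpace ℝ (Fin d) → EuclideanSpace ℝ (Fin d))
    (Kθ Ku : ℝ)
    (hKθ : ∀ v, ‖θ v‖ ≤ Kθ)
    (hKu : IsGreatest ((fun u => ‖u‖) '' U) Ku) :
    ∀ v : EuclideanSpace ℝ (Fin d),
      0 ≤ G δ P U θ v 0 ∧ G δ P U θ v 0 ≤ δ * (Kθ + Ku)^2 / (2 * (1 - δ)) := by
  intro v
  have hpos : 0 < 1 - δ := sub_pos.mpr hδ.2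
  have hbdd (u : EuclideanSpace ℝ (Fin d)) : BddAbove ((fun p => F δ (θ v) 0 p u) '' P) :=
    ⟨_, Set.forall_mem_image.2 fun p _ => F_zero_le hδ (θ v) p u⟩
  have hnonneg (u : EuclideanSpace ℝ (Fin d)) :
      0 ≤ sSup ((fun p => F δ (θ v) 0 p u) '' P) :=
    le_csSup (hbdd u) ⟨0, hP0, F_zero_zero δ (θ v) u⟩
  refine ⟨Real.sInf_nonneg (Set.forall_mem_image.2 fun u _ => hnonneg u), ?_⟩
  obtain ⟨u, hu⟩ := hUne
  have hnorm : ‖θ v + u‖ ≤ Kθ + Ku :=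
    (norm_add_le _ _).trans (add_le_add (hKθ v) (hKu.2 ⟨u, hu, rfl⟩))
  have hδ0 : 0 ≤ δ := hδ.1.le
  calc G δ P U θ v 0 ≤ sSup ((fun p => F δ (θ v) 0 p u) '' P) :=
        csInf_le ⟨0, Set.forall_mem_image.2 fun u _ => hnonneg u⟩ ⟨u, hu, rfl⟩
    _ ≤ δ * ‖θ v + u‖^2 / (2 * (1 - δ)) :=
        csSup_le (hPne.image _) (Set.forall_mem_image.2 fun p _ => F_zero_le hδ (θ v) p u)
    _ ≤ δ * (Kθ + Ku)^2 / (2 * (1 - δ)) := by gcongr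
end

section
/- For every θ, z ∈ ℝ^d: inf_{u∈U} sup_{π∈ℝ^d} F(θ, z, π, u) = (δ/(2(1−δ)))·dist(−θ − z/δ, U)² − (1/(2δ))‖z‖² − ⟪z, θ⟫. Moreover, for each u ∈ U the inner supremum over π ∈ ℝ^d is attained at π = (θ + z + u)/(1 − δ), and the outer infimum over U is attained at u* = Proj_U(−θ − z/δ). -/
open RealInnerProductSpace

/-- Completing the square: the Hamiltonian as a function of the portfolio `p` and the control `u`. -/
theorem F_eq_sub_sq {d : ℕ} {δ : ℝ} (h0 : δ ≠ 0) (h1 : 1 - δ ≠ 0)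
    (θ z p u : EuclideanSpace ℝ (Fin d)) :
    F δ θ z p u = (δ / (2 * (1 - δ))) * ‖-θ - δ⁻¹ • z - u‖ ^ 2 - (1 / (2 * δ)) * ‖z‖ ^ 2 - ⟪z, θ⟫
      - (1 / 2) * δ * (1 - δ) * ‖p - (1 - δ)⁻¹ • (θ + z + u)‖ ^ 2 := by
  simp only [F, ← real_inner_self_eq_norm_sq, inner_add_left, inner_add_right, inner_sub_left,
    inner_sub_right, inner_neg_left, inner_neg_right, real_inner_smul_left, real_inner_smul_right]
  rw [real_inner_comm z θ, real_inner_comm u θ, real_inner_comm u z, real_inner_comm θ p,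
    real_inner_comm z p, real_inner_comm u p]
  field_simp
  ring

/-- The portfolio `(θ + z + u) / (1 - δ)` maximizes the Hamiltonian. -/
theorem isMaxOn_F {d : ℕ} {δ : ℝ} (hδ : δ ∈ Set.Ioo (0 : ℝ) 1)
    (θ z u : EuclideanSpace ℝ (Fin d)) :
    IsMaxOn (fun p => F δ θ z p u) Set.univ ((1 - δ)⁻¹ • (θ + z + u)) := by
  have h1 : 0 < 1 - δ := sub_pos.2 hδ.2
  have h0 := hδ.1
  intro p _
  simp only [Set.mem_ofPred_eq, F_eq_sub_sq h0.ne' h1.ne', sub_self, norm_zero]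
  have : 0 ≤ (1 / 2) * δ * (1 - δ) * ‖p - (1 - δ)⁻¹ • (θ + z + u)‖ ^ 2 := by positivity
  linarith

/-- The maximal value of the Hamiltonian over all portfolios. -/
theorem iSup_F {d : ℕ} {δ : ℝ} (hδ : δ ∈ Set.Ioo (0 : ℝ) 1)
    (θ z u : EuclideanSpace ℝ (Fin d)) :
    ⨆ p, F δ θ z p u = (δ / (2 * (1 - δ))) * ‖-θ - δ⁻¹ • z - u‖ ^ 2
      - (1 / (2 * δ)) * ‖z‖ ^ 2 - ⟪z, θ⟫ := by
  have hmax : ∀ p, F δ θ z p u ≤ F δ θ z ((1 - δ)⁻¹ • (θ + z + u)) u :=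
    fun p => isMaxOn_F hδ θ z u (Set.mem_univ p)
  have hsup : ⨆ p, F δ θ z p u = F δ θ z ((1 - δ)⁻¹ • (θ + z + u)) u :=
    le_antisymm (ciSup_le hmax) (le_ciSup (f := fun p => F δ θ z p u)
      ⟨_, Set.forall_mem_range.2 hmax⟩ _)
  rw [hsup, F_eq_sub_sq hδ.1.ne' (sub_pos.2 hδ.2).ne']
  simp

/-- The distance to a set is realized by any nearest point. -/
theorem infDist_eq_norm_sub_of_forall_le {E : Type*} [SeminormedAddCommGroup E] {s : Set E}
    {x y : E} (hy : y ∈ s) (h : ∀ w ∈ s, ‖x - y‖ ≤ ‖x - w‖) : Metric.infDist x s = ‖x - y‖ := by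
  refine le_antisymm ((Metric.infDist_le_dist_of_mem hy).trans_eq (dist_eq_norm x y)) ?_
  refine (Metric.le_infDist ⟨y, hy⟩).2 fun w hw => ?_
  rw [dist_eq_norm]
  exact h w hw

/-- the unconstrained min-max value
`inf_{u∈U} sup_{π∈ℝ^d} F(θ,z,π,u) = (δ/(2(1-δ)))·dist(-θ - z/δ, U)² - ‖z‖²/(2δ) - ⟪z,θ⟫`,
the inner supremum being attained at `π = (θ+z+u)/(1-δ)` and the outer infimum at
`u* = Proj_U(-θ - z/δ)`. -/
theorem stmt_9 {d : ℕ} (hd : 1 ≤ d) {δ : ℝ} (hδ : δ ∈ Set.Ioo (0:ℝ) 1)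
    (U : Set (EuclideanSpace ℝ (Fin d)))
    (hUne : U.Nonempty) (hUcomp : IsCompact U) (hUconv : Convex ℝ U)
    (projU : EuclideanSpace ℝ (Fin d) → EuclideanSpace ℝ (Fin d))
    (hprojU : ∀ x, projU x ∈ U ∧ ∀ y ∈ U, ‖x - projU x‖ ≤ ‖x - y‖)
    (θ z : EuclideanSpace ℝ (Fin d)) :
    sInf ((fun u => ⨆ p, F δ θ z p u) '' U) =
      (δ / (2 * (1 - δ))) * Metric.infDist (-θ - δ⁻¹ • z) U ^ 2
        - (1 / (2 * δ)) * ‖z‖^2 - ⟪z, θ⟫ ∧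
    (∀ u ∈ U, IsMaxOn (fun p => F δ θ z p u) Set.univ ((1 - δ)⁻¹ • (θ + z + u))) ∧
    IsMinOn (fun u => ⨆ p, F δ θ z p u) U (projU (-θ - δ⁻¹ • z)) := by
  obtain ⟨hmem, hle⟩ := hprojU (-θ - δ⁻¹ • z)
  have hmin : IsMinOn (fun u => ⨆ p, F δ θ z p u) U (projU (-θ - δ⁻¹ • z)) := by
    intro u hu
    have h1 : 0 < 1 - δ := sub_pos.2 hδ.2
    have h0 := hδ.1
    simp only [Set.mem_ofPred_eq, iSup_F hδ]
    have := hle u hu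
    gcongr
  refine ⟨?_, fun u _ => isMaxOn_F hδ θ z u, hmin⟩
  have hleast : IsLeast ((fun u => ⨆ p, F δ θ z p u) '' U)
      (⨆ p, F δ θ z p (projU (-θ - δ⁻¹ • z))) :=
    ⟨Set.mem_image_of_mem _ hmem, Set.forall_mem_image.2 fun u hu => hmin hu⟩
  rw [hleast.csInf_eq, iSup_F hδ, infDist_eq_norm_sub_of_forall_le hmem hle]
end

section
/- For all real θ, z₁, z₂: inf_{(u₁,u₂)∈U_R} sup_{π₁∈ℝ} F₂(θ, z₁, z₂, π₁, u₁, u₂) = (δ/(2(1−δ)))·dist(−θ − z₁/δ − ((1−δ)/δ)z₂·1_{z₂≥0}, [−R,R])² − z₁²/(2δ) − θz₁ + ((2δ−1)/(2δ)·z₂ − z₁/δ − θ)·z₂·1_{z₂≥0} + ((1/2)z₂ + R)·z₂·1_{z₂<0}, where 1_{z₂≥0} equals 1 if z₂ ≥ 0 and 0 otherwise, and 1_{z₂<0} = 1 − 1_{z₂≥0}. -/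
/-- The Hamiltonian `F₂(θ, z₁, z₂, π₁, u₁, u₂)` for the single stock, single stochastic
factor model. -/
noncomputable def F2 (δ θ z1 z2 p1 u1 u2 : ℝ) : ℝ :=
  -(1/2) * δ * (1 - δ) * p1^2 + δ * p1 * (θ + z1 + u1) + z1 * u1 + z2 * u2
    + (1/2) * (z1^2 + z2^2)

/-- Maximizing the concave quadratic `F2` in its portfolio variable. -/
lemma iSup_F2 {δ : ℝ} (hδ : δ ∈ Set.Ioo (0:ℝ) 1) (θ z1 z2 u1 u2 : ℝ) :
    ⨆ p : ℝ, F2 δ θ z1 z2 p u1 u2 =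
      δ / (2 * (1 - δ)) * (θ + z1 + u1)^2 + z1 * u1 + z2 * u2 + (1/2) * (z1^2 + z2^2) := by
  obtain ⟨h0, h1⟩ := hδ
  have h2 : 0 < 1 - δ := by linarith
  have key (p : ℝ) : F2 δ θ z1 z2 p u1 u2 =
      δ / (2 * (1 - δ)) * (θ + z1 + u1)^2 + z1 * u1 + z2 * u2 + (1/2) * (z1^2 + z2^2)
        - δ * (1 - δ) / 2 * (p - (θ + z1 + u1) / (1 - δ))^2 := by
    unfold F2
    field_simp
    ring
  refine IsGreatest.csSup_eq ⟨⟨(θ + z1 + u1) / (1 - δ), ?_⟩, ?_⟩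
  · simp [key]
  · rintro _ ⟨p, rfl⟩
    have : 0 ≤ δ * (1 - δ) / 2 * (p - (θ + z1 + u1) / (1 - δ))^2 := by positivity
    simp only [key]
    linarith

/-- If `f` is bounded below on `S` by `k (c - g q)² + d`, where `g` maps `S` into a compact set `K`,
and the bound is attained over each point of `K`, then the infimum of `f` is given by the distance
from `c` to `K`. -/
lemma sInf_image_eq_infDist_sq {α : Type*} {S : Set α} {K : Set ℝ} (hK : IsCompact K)
    (hne : K.Nonempty) {f g : α → ℝ} {k c d : ℝ} (hk : 0 ≤ k) (hg : Set.MapsTo g S K)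
    (hle : ∀ q ∈ S, k * (c - g q)^2 + d ≤ f q)
    (hatt : ∀ u ∈ K, ∃ q ∈ S, f q = k * (c - u)^2 + d) :
    sInf (f '' S) = k * Metric.infDist c K ^ 2 + d := by
  obtain ⟨u, hu, hdist⟩ := hK.exists_infDist_eq_dist hne c
  refine IsLeast.csInf_eq ⟨?_, ?_⟩
  · obtain ⟨q, hq, hfq⟩ := hatt u hu
    exact ⟨q, hq, by rw [hfq, hdist, Real.dist_eq, sq_abs]⟩
  · rintro _ ⟨q, hq, rfl⟩
    refine le_trans ?_ (hle q hq)
    have h := Metric.infDist_le_dist_of_mem (x := c) (hg hq)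
    rw [← sq_abs (c - g q), ← Real.dist_eq]
    have := Metric.infDist_nonneg (x := c) (s := K)
    gcongr

/-- explicit formula for
`inf_{(u₁,u₂)∈U_R} sup_{π₁∈ℝ} F₂(θ, z₁, z₂, π₁, u₁, u₂)` in terms of the distance to
`[-R,R]` and indicator functions of the sign of `z₂`. -/
theorem stmt_11 {δ R : ℝ} (hδ : δ ∈ Set.Ioo (0:ℝ) 1) (hR : 0 < R)
    (θ z1 z2 : ℝ) :
    sInf ((fun q : ℝ × ℝ => ⨆ p1 : ℝ, F2 δ θ z1 z2 p1 q.1 q.2) ''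
        {q : ℝ × ℝ | -R ≤ q.1 ∧ q.1 ≤ q.2 ∧ q.2 ≤ R}) =
      (δ / (2 * (1 - δ))) *
        Metric.infDist
          (-θ - z1 / δ - ((1 - δ) / δ) * z2 * (if 0 ≤ z2 then (1:ℝ) else 0))
          (Set.Icc (-R) R) ^ 2
      - z1^2 / (2 * δ) - θ * z1
      + ((2 * δ - 1) / (2 * δ) * z2 - z1 / δ - θ) * z2 * (if 0 ≤ z2 then (1:ℝ) else 0)
      + ((1/2) * z2 + R) * z2 * (1 - (if 0 ≤ z2 then (1:ℝ) else 0)) := by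
  have h0 := hδ.1
  have h2 : 0 < 1 - δ := sub_pos.2 hδ.2
  have hk : 0 ≤ δ / (2 * (1 - δ)) := by positivity
  have hne : (Set.Icc (-R) R).Nonempty := Set.nonempty_Icc.2 (by linarith)
  simp only [iSup_F2 hδ]
  by_cases hz : 0 ≤ z2
  · simp only [if_pos hz, mul_one, sub_self, mul_zero, add_zero]
    have key (u : ℝ) : δ / (2 * (1 - δ)) * (θ + z1 + u)^2 + z1 * u + z2 * u
        + (1/2) * (z1^2 + z2^2) =
        δ / (2 * (1 - δ)) * (-θ - z1 / δ - ((1 - δ) / δ) * z2 - u)^2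
          + (- z1^2 / (2 * δ) - θ * z1 + ((2 * δ - 1) / (2 * δ) * z2 - z1 / δ - θ) * z2) := by
      field_simp
      ring
    refine Eq.trans (sInf_image_eq_infDist_sq isCompact_Icc hne (g := Prod.fst) hk
      (fun q hq => ⟨hq.1, hq.2.1.trans hq.2.2⟩) (fun q hq => ?_)
      (fun u hu => ⟨(u, u), ⟨hu.1, le_rfl, hu.2⟩, key u⟩)) ?_
    · rw [← key]
      have := mul_le_mul_of_nonneg_left hq.2.1 hz
      linarith
    · ring
  · simp only [if_neg hz, mul_zero, sub_zero, add_zero, mul_one]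
    have key (u : ℝ) : δ / (2 * (1 - δ)) * (θ + z1 + u)^2 + z1 * u + z2 * R
        + (1/2) * (z1^2 + z2^2) =
        δ / (2 * (1 - δ)) * (-θ - z1 / δ - u)^2
          + (- z1^2 / (2 * δ) - θ * z1 + ((1/2) * z2 + R) * z2) := by
      field_simp
      ring
    refine Eq.trans (sInf_image_eq_infDist_sq isCompact_Icc hne (g := Prod.fst) hk
      (fun q hq => ⟨hq.1, hq.2.1.trans hq.2.2⟩) (fun q hq => ?_)
      (fun u hu => ⟨(u, R), ⟨hu.1, hu.2, le_rfl⟩, key u⟩)) ?_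
    · rw [← key]
      have := mul_le_mul_of_nonpos_left hq.2.2 (not_le.1 hz).le
      linarith
    · ring
end

section
/- For all real θ, z, the function π ↦ −(1/2)π² + πθ + min(0, π + z − 1/2) attains its maximum over ℝ at π̃* given by: π̃* = θ + 1 if 1/2 − z ≥ θ + 1; π̃* = 1/2 − z if θ ≤ 1/2 − z ≤ θ + 1; and π̃* = θ if 1/2 − z ≤ θ (i.e., π̃* is the clamp of 1/2 − z onto the interval [θ, θ + 1]). -/
/-- the function `π ↦ -(1/2)π² + πθ + min(0, π + z - 1/2)` attains its
maximum over `ℝ` at `π̃* = clamp of (1/2 - z) onto [θ, θ+1]`, i.e. `π̃* = θ + 1` if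
`1/2 - z ≥ θ + 1`, `π̃* = 1/2 - z` if `θ ≤ 1/2 - z ≤ θ + 1`, and `π̃* = θ` if
`1/2 - z ≤ θ`. -/
theorem stmt_14 (θ z : ℝ) :
    IsMaxOn (fun p : ℝ => -(1/2) * p^2 + p * θ + min 0 (p + z - 1/2)) Set.univ
      (max θ (min (θ + 1) (1/2 - z))) ∧
    (θ + 1 ≤ 1/2 - z → max θ (min (θ + 1) (1/2 - z)) = θ + 1) ∧
    (θ ≤ 1/2 - z → 1/2 - z ≤ θ + 1 → max θ (min (θ + 1) (1/2 - z)) = 1/2 - z) ∧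
    (1/2 - z ≤ θ → max θ (min (θ + 1) (1/2 - z)) = θ) := by
  have h₁ (h : θ + 1 ≤ 1/2 - z) : max θ (min (θ + 1) (1/2 - z)) = θ + 1 := by
    rw [min_eq_left h, max_eq_right (by linarith)]
  have h₂ (h : θ ≤ 1/2 - z) (h' : 1/2 - z ≤ θ + 1) :
      max θ (min (θ + 1) (1/2 - z)) = 1/2 - z := by
    rw [min_eq_right h', max_eq_right h]
  have h₃ (h : 1/2 - z ≤ θ) : max θ (min (θ + 1) (1/2 - z)) = θ :=
    max_eq_left ((min_le_right _ _).trans h)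
  refine ⟨fun p _ => ?_, h₁, h₂, h₃⟩
  simp only [Set.mem_ofPred_eq]
  have hl := min_le_left 0 (p + z - 1/2)
  have hr := min_le_right 0 (p + z - 1/2)
  rcases le_total (1/2 - z) θ with h | h
  · rw [h₃ h, min_eq_left (show 0 ≤ θ + z - 1/2 by linarith)]
    nlinarith [sq_nonneg (p - θ)]
  rcases le_total (θ + 1) (1/2 - z) with h' | h'
  · rw [h₁ h', min_eq_right (show θ + 1 + z - 1/2 ≤ 0 by linarith)]
    nlinarith [sq_nonneg (p - (θ + 1))]
  · rw [h₂ h h', min_eq_left (show 0 ≤ 1/2 - z + z - 1/2 by linarith)]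
    rcases le_total p (1/2 - z) with hp | hp
    · nlinarith [sq_nonneg (p - (1/2 - z)),
        mul_nonneg (sub_nonneg.2 hp) (sub_nonneg.2 h')]
    · nlinarith [sq_nonneg (p - (1/2 - z)),
        mul_nonneg (sub_nonneg.2 hp) (sub_nonneg.2 h)]
end
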